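/- arXiv:2308.08152 — 2 statements merged into one kernel-verified Lean document; each statement's English description precedes it below -/
import Mathlib

section
/- Let 𝕋 = {t_1 < t_2 < ⋯ < t_K} ⊆ {1,…,T}, set t_0 = 0, t_{K+1} = T and Δ_k = t_k − t_{k−1} for k = 1,…,K+1. Suppose longitudinal surrogacy holds at every time r ∈ 𝕋 and comparability holds. Then the average effect of the long-term treatment satisfies τ_T = Σ_{x ∈ 𝕏} Σ_{s₀ ∈ 𝕊} Σ_{s_1,…,s_K ∈ 𝕊} [ h_{Δ_{K+1}}(s_K, x, 1)·Π_{k=1}^{K} p_{Δ_k}(s_{k−1}, s_k; x, 1) − h_{Δ_{K+1}}(s_K, x, 0)·Π_{k=1}^{K} p_{Δ_k}(s_{k−1}, s_k; x, 0) ]·P(X = x, S_0 = s₀), where in the products s_0 denotes the value s₀ of the pre-treatment surrogate. -/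
open MeasureTheory ProbabilityTheory

/-- The sequence `s₀, σ 0, σ 1, …, σ (K-1)` of surrogate values, indexed by `ℕ`. -/
def extSeq {α : Type*} (s₀ : α) {K : ℕ} (σ : Fin K → α) : ℕ → α :=
  fun k => match k with
  | 0 => s₀
  | Nat.succ j => if h : j < K then σ ⟨j, h⟩ else s₀

theorem setIntegral_eq_sum_fiber {Ω ι : Type*} [MeasurableSpace Ω] {P : Measure Ω}
    (I : Finset ι) (Z : Ω → ι) (hZ : ∀ ω, Z ω ∈ I) (hZm : ∀ i, MeasurableSet {ω | Z ω = i})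
    {B : Set Ω} (hB : MeasurableSet B) {f : Ω → ℝ} (hf : Integrable f P) :
    ∫ ω in B, f ω ∂P = ∑ i ∈ I, ∫ ω in B ∩ {ω | Z ω = i}, f ω ∂P := by
  rw [← integral_biUnion_finset I (fun i _ => hB.inter (hZm i)) _
    (fun i _ => hf.integrableOn)]
  · congr 2
    ext ω
    simp [hZ ω]
  · intro i _ j _ hij
    refine Set.disjoint_left.2 fun ω hi hj => hij ?_
    exact hi.2.symm.trans hj.2

theorem integral_cond_eq {Ω : Type*} [MeasurableSpace Ω] (P : Measure Ω) (C : Set Ω)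
    (f : Ω → ℝ) : ∫ ω, f ω ∂(P[|C]) = (P.real C)⁻¹ * ∫ ω in C, f ω ∂P := by
  simp [ProbabilityTheory.cond, integral_smul_measure, Measure.real]

/-- If the conditional law of `W` on each nonnull piece of a finite partition of `B` is `ν`,
then integrals of functions of `W` over `B` are computed by `ν`. -/
theorem setIntegral_eq_of_map_cond_fiber_eq {Ω ι E : Type*} [MeasurableSpace Ω]
    [MeasurableSpace E] {P : Measure Ω} [IsFiniteMeasure P]
    (I : Finset ι) (Z : Ω → ι) (hZ : ∀ ω, Z ω ∈ I) (hZm : ∀ i, MeasurableSet {ω | Z ω = i})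
    {B : Set Ω} (hB : MeasurableSet B) {W : Ω → E} (hW : Measurable W) {ν : Measure E}
    (hν : ∀ i, P (B ∩ {ω | Z ω = i}) ≠ 0 → Measure.map W (P[|B ∩ {ω | Z ω = i}]) = ν)
    {f : E → ℝ} (hf : Measurable f) (hfW : Integrable (fun ω => f (W ω)) P) :
    ∫ ω in B, f (W ω) ∂P = P.real B * ∫ e, f e ∂ν := by
  have hmass : P.real B = ∑ i ∈ I, P.real (B ∩ {ω | Z ω = i}) := by
    simpa using setIntegral_eq_sum_fiber I Z hZ hZm hB (integrable_const (μ := P) (1 : ℝ))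
  rw [setIntegral_eq_sum_fiber I Z hZ hZm hB hfW, hmass, Finset.sum_mul]
  refine Finset.sum_congr rfl fun i _ => ?_
  by_cases h0 : P (B ∩ {ω | Z ω = i}) = 0
  · rw [setIntegral_measure_zero _ h0]
    simp [Measure.real, h0]
  · have h0' : P.real (B ∩ {ω | Z ω = i}) ≠ 0 := by
      simpa [Measure.real, ENNReal.toReal_eq_zero_iff] using h0
    rw [← hν i h0, integral_map hW.aemeasurable hf.aestronglyMeasurable, integral_cond_eq]
    field_simp

theorem extSeq_mem {α : Type*} {I : Finset α} {s₀ : α} (hs₀ : s₀ ∈ I) {K : ℕ} {σ : Fin K → α}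
    (hσ : ∀ i, σ i ∈ I) (k : ℕ) : extSeq s₀ σ k ∈ I := by
  cases k with
  | zero => exact hs₀
  | succ j =>
    simp only [extSeq]
    split_ifs
    · exact hσ _
    · exact hs₀

theorem measurableSet_eq_fun_fin {Ω E : Type*} [MeasurableSpace Ω] [MeasurableSpace E]
    [MeasurableSingletonClass E] {n : ℕ} {V : Fin n → Ω → E} (hV : ∀ i, Measurable (V i))
    (g : Fin n → E) : MeasurableSet {ω | (fun i => V i ω) = g} := by
  simp only [funext_iff, Set.ofPred_forall]
  exact MeasurableSet.iInter fun i => hV i (measurableSet_singleton _)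

/-- Path expansion: if the mass of path events multiplies by `q` at each step and the terminal
integral is governed by `g`, the integral over an initial event is a sum over paths. -/
theorem setIntegral_eq_sum_paths {Ω E : Type*} [MeasurableSpace Ω] [MeasurableSpace E]
    [MeasurableSingletonClass E] {P : Measure Ω}
    (I : Finset E) {V : ℕ → Ω → E} (hV : ∀ k, Measurable (V k)) (hVI : ∀ k ω, V k ω ∈ I)
    {C : Set Ω} (hC : MeasurableSet C) {Y : Ω → ℝ} (hY : Integrable Y P) (K : ℕ)
    (q : ℕ → E → E → ℝ) (g : E → ℝ)
    (hq : ∀ k < K, ∀ v : ℕ → E, (∀ i, v i ∈ I) →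
      P.real {ω | (∀ i ≤ k + 1, V i ω = v i) ∧ ω ∈ C}
        = P.real {ω | (∀ i ≤ k, V i ω = v i) ∧ ω ∈ C} * q k (v k) (v (k + 1)))
    (hg : ∀ v : ℕ → E, (∀ i, v i ∈ I) →
      ∫ ω in {ω | (∀ i ≤ K, V i ω = v i) ∧ ω ∈ C}, Y ω ∂P
        = P.real {ω | (∀ i ≤ K, V i ω = v i) ∧ ω ∈ C} * g (v K))
    {s₀ : E} (hs₀ : s₀ ∈ I) :
    ∫ ω in {ω | V 0 ω = s₀ ∧ ω ∈ C}, Y ω ∂P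
      = P.real {ω | V 0 ω = s₀ ∧ ω ∈ C} * ∑ σ ∈ Fintype.piFinset (fun _ : Fin K => I),
        g (extSeq s₀ σ K)
          * ∏ k ∈ Finset.range K, q k (extSeq s₀ σ k) (extSeq s₀ σ (k + 1)) := by
  have hprod : ∀ v : ℕ → E, (∀ i, v i ∈ I) → ∀ k ≤ K,
      P.real {ω | (∀ i ≤ k, V i ω = v i) ∧ ω ∈ C}
        = P.real {ω | V 0 ω = v 0 ∧ ω ∈ C} * ∏ j ∈ Finset.range k, q j (v j) (v (j + 1)) := by
    intro v hv k
    induction k with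
    | zero => simp
    | succ k ih =>
      intro hk
      rw [hq k hk v hv, ih (Nat.le_of_succ_le hk), Finset.prod_range_succ, mul_assoc]
  have hm : MeasurableSet {ω | V 0 ω = s₀ ∧ ω ∈ C} :=
    (hV 0 (measurableSet_singleton s₀)).inter hC
  rw [setIntegral_eq_sum_fiber (Fintype.piFinset (fun _ : Fin K => I))
    (fun ω (i : Fin K) => V (i + 1) ω) (fun ω => Fintype.mem_piFinset.2 fun i => hVI _ _)
    (measurableSet_eq_fun_fin fun i => hV _) hm hY, Finset.mul_sum]
  refine Finset.sum_congr rfl fun σ hσ => ?_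
  have hv := extSeq_mem hs₀ (Fintype.mem_piFinset.1 hσ)
  have hset : {ω | V 0 ω = s₀ ∧ ω ∈ C} ∩ {ω | (fun i : Fin K => V (i + 1) ω) = σ}
      = {ω | (∀ i ≤ K, V i ω = extSeq s₀ σ i) ∧ ω ∈ C} := by
    ext ω
    simp only [Set.mem_inter_iff, Set.mem_ofPred_eq, funext_iff]
    constructor
    · rintro ⟨⟨h0, hc⟩, h1⟩
      refine ⟨fun i hi => ?_, hc⟩
      cases i with
      | zero => exact h0
      | succ j =>
        have hj : j < K := hi
        simpa [extSeq, hj] using h1 ⟨j, hj⟩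
    · rintro ⟨h1, hc⟩
      refine ⟨⟨h1 0 (Nat.zero_le _), hc⟩, fun i => ?_⟩
      simpa [extSeq] using h1 (i + 1) i.2
  rw [hset, hg _ hv, hprod _ hv K le_rfl]
  simp only [extSeq]
  ring

/-- Theorem 1 (longitudinal surrogate model): under longitudinal surrogacy at every
time in `𝕋 = {t 1 < … < t K}` and comparability, the average effect of the long-term
treatment is identified by iterating the transition probabilities through the pivot
times and applying the surrogate index at the end. -/
theorem longitudinal_surrogate_model
    {Ω : Type*} [MeasurableSpace Ω] (P : Measure Ω) [IsProbabilityMeasure P]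
    {𝕏 : Type*} [Fintype 𝕏] [MeasurableSpace 𝕏] [MeasurableSingletonClass 𝕏]
    (D T_E T_F : ℕ) (hD : 0 < D) (hTE : 0 < T_E) (hTF : 0 < T_F)
    (𝕊 : Finset (Fin D → ℝ))
    (X : Ω → 𝕏) (hX : Measurable X)
    (S : ℕ → Ω → (Fin D → ℝ)) (hSmeas : ∀ t, Measurable (S t))
    (hSmem : ∀ t ω, S t ω ∈ 𝕊)
    (Y : ℕ → Ω → ℝ) (hYmeas : ∀ t, Measurable (Y t)) (hYint : ∀ t, Integrable (Y t) P)
    (A : Ω → Bool) (hA : Measurable A)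
    -- randomized assignment: `A` is independent of `(X, S_0)`
    (hindep : IndepFun (fun ω => (X ω, S 0 ω)) A P)
    -- all conditioning events have positive probability
    (hApos : ∀ a : Bool, P {ω | A ω = a} ≠ 0)
    (hpos : ∀ r, r ≤ T_E + T_F → ∀ s ∈ 𝕊, ∀ (x : 𝕏) (a : Bool),
      P {ω | S r ω = s ∧ X ω = x ∧ A ω = a} ≠ 0)
    -- the pivot times `t 0 = 0 < t 1 < … < t K < t (K+1) = T`
    (K : ℕ) (t : ℕ → ℕ)
    (ht0 : t 0 = 0) (htlast : t (K + 1) = T_E + T_F)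
    (htmono : ∀ k, k ≤ K → t k < t (k + 1))
    -- longitudinal surrogacy at every time `r ∈ 𝕋`
    (hsurr : ∀ k, 1 ≤ k → k ≤ K → ∀ t', t k < t' → t' ≤ T_E + T_F →
      ∀ s ∈ 𝕊, ∀ (x : 𝕏) (a : Bool) (hist : ℕ → (Fin D → ℝ)),
        P {ω | (∀ i < t k, S i ω = hist i) ∧ S (t k) ω = s ∧ X ω = x ∧ A ω = a} ≠ 0 →
        Measure.map (fun ω => (Y t' ω, S t' ω))
            (P[|{ω | (∀ i < t k, S i ω = hist i) ∧ S (t k) ω = s ∧ X ω = x ∧ A ω = a}])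
          = Measure.map (fun ω => (Y t' ω, S t' ω))
            (P[|{ω | S (t k) ω = s ∧ X ω = x ∧ A ω = a}]))
    -- comparability
    (hcomp : ∀ r u r' u', r < u → u ≤ T_E + T_F → r' < u' → u' ≤ T_E + T_F →
      u - r = u' - r' → ∀ s ∈ 𝕊, ∀ (x : 𝕏) (a : Bool),
        Measure.map (fun ω => (Y u ω, S u ω)) (P[|{ω | S r ω = s ∧ X ω = x ∧ A ω = a}])
          = Measure.map (fun ω => (Y u' ω, S u' ω)) (P[|{ω | S r' ω = s ∧ X ω = x ∧ A ω = a}]))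
    -- the surrogate index
    (h : ℕ → (Fin D → ℝ) → 𝕏 → Bool → ℝ)
    (hdef : ∀ u s x a,
      h u s x a = ∫ ω, Y u ω ∂(P[|{ω | S 0 ω = s ∧ X ω = x ∧ A ω = a}]))
    -- the transition probabilities
    (p : ℕ → (Fin D → ℝ) → (Fin D → ℝ) → 𝕏 → Bool → ℝ)
    (pdef : ∀ u s s' x a,
      p u s s' x a = ((P[|{ω | S 0 ω = s ∧ X ω = x ∧ A ω = a}]) {ω | S u ω = s'}).toReal) :
    (∫ ω, Y (T_E + T_F) ω ∂(P[|{ω | A ω = true}]))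
      - (∫ ω, Y (T_E + T_F) ω ∂(P[|{ω | A ω = false}]))
    = ∑ x : 𝕏, ∑ s₀ ∈ 𝕊, ∑ σ ∈ Fintype.piFinset (fun _ : Fin K => 𝕊),
        (h (t (K + 1) - t K) (extSeq s₀ σ K) x true
            * ∏ k ∈ Finset.range K,
                p (t (k + 1) - t k) (extSeq s₀ σ k) (extSeq s₀ σ (k + 1)) x true
          - h (t (K + 1) - t K) (extSeq s₀ σ K) x false
            * ∏ k ∈ Finset.range K,
                p (t (k + 1) - t k) (extSeq s₀ σ k) (extSeq s₀ σ (k + 1)) x false)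
          * (P {ω | X ω = x ∧ S 0 ω = s₀}).toReal := by
  have htlt : ∀ i j, i < j → j ≤ K + 1 → t i < t j := by
    intro i j hij
    induction j, hij using Nat.le_induction with
    | base => exact fun hj => htmono i (by omega)
    | succ j _ ih => exact fun hj => (ih (by omega)).trans (htmono j (by omega))
  have htle : ∀ k ≤ K + 1, t k ≤ T_E + T_F := by
    intro k hk
    rcases hk.eq_or_lt with rfl | hk
    · exact htlast.le
    · exact htlast ▸ (htlt k (K + 1) hk le_rfl).le
  have hXA : ∀ x a, MeasurableSet {ω | X ω = x ∧ A ω = a} := fun x a =>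
    (hX (measurableSet_singleton x)).inter (hA (measurableSet_singleton a))
  have hpath : ∀ k (v : ℕ → Fin D → ℝ) x a, MeasurableSet
      {ω | (∀ i ≤ k, S (t i) ω = v i) ∧ ω ∈ {ω | X ω = x ∧ A ω = a}} := by
    intro k v x a
    refine MeasurableSet.inter (s₁ := {ω | ∀ i ≤ k, S (t i) ω = v i}) ?_ (hXA x a)
    simp only [Set.ofPred_forall]
    exact MeasurableSet.iInter fun i => MeasurableSet.iInter fun _ =>
      hSmeas _ (measurableSet_singleton _)
  -- Markov-type step from the pivot time `t k` to `t (k + 1)`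
  have hstep : ∀ k ≤ K, ∀ x a, ∀ v : ℕ → Fin D → ℝ, (∀ i, v i ∈ 𝕊) →
      ∀ f : ℝ × (Fin D → ℝ) → ℝ, Measurable f →
      Integrable (fun ω => f (Y (t (k + 1)) ω, S (t (k + 1)) ω)) P →
      ∫ ω in {ω | (∀ i ≤ k, S (t i) ω = v i) ∧ ω ∈ {ω | X ω = x ∧ A ω = a}},
          f (Y (t (k + 1)) ω, S (t (k + 1)) ω) ∂P
        = P.real {ω | (∀ i ≤ k, S (t i) ω = v i) ∧ ω ∈ {ω | X ω = x ∧ A ω = a}}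
          * ∫ ω, f (Y (t (k + 1) - t k) ω, S (t (k + 1) - t k) ω)
              ∂(P[|{ω | S 0 ω = v k ∧ X ω = x ∧ A ω = a}]) := by
    intro k hk x a v hv f hf hfi
    have hlt := htmono k hk
    have hle := htle (k + 1) (by omega)
    rw [← integral_map (f := f)
        (φ := fun ω => (Y (t (k + 1) - t k) ω, S (t (k + 1) - t k) ω))
        ((hYmeas _).prodMk (hSmeas _)).aemeasurable
      hf.aestronglyMeasurable,
      ← hcomp (t k) (t (k + 1)) 0 (t (k + 1) - t k) hlt hle (by omega) (by omega) (by omega)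
        (v k) (hv k) x a]
    refine setIntegral_eq_of_map_cond_fiber_eq (Fintype.piFinset (fun _ : Fin (t k) => 𝕊))
      (fun ω (i : Fin (t k)) => S i ω) (fun ω => Fintype.mem_piFinset.2 fun i => hSmem _ _)
      (measurableSet_eq_fun_fin fun i => hSmeas _) (hpath k v x a)
      ((hYmeas _).prodMk (hSmeas _)) ?_ hf hfi
    intro g hg
    obtain ⟨ω₀, ⟨hv₀, -⟩, hg₀⟩ := nonempty_of_measure_ne_zero hg
    have hset : {ω | (∀ i ≤ k, S (t i) ω = v i) ∧ ω ∈ {ω | X ω = x ∧ A ω = a}}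
          ∩ {ω | (fun i : Fin (t k) => S i ω) = g}
        = {ω | (∀ i < t k, S i ω = S i ω₀) ∧ S (t k) ω = v k ∧ X ω = x ∧ A ω = a} := by
      ext ω
      simp only [Set.mem_inter_iff, Set.mem_ofPred_eq] at hg₀ ⊢
      rw [← hg₀, funext_iff]
      constructor
      · rintro ⟨⟨h1, h2⟩, h3⟩
        exact ⟨fun i hi => h3 ⟨i, hi⟩, h1 k le_rfl, h2⟩
      · rintro ⟨h3, h1, h2⟩
        refine ⟨⟨fun i hi => ?_, h2⟩, fun i => h3 i i.2⟩
        rcases hi.eq_or_lt with rfl | hi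
        · exact h1
        · rw [h3 _ (htlt i k hi (by omega)), hv₀ i hi.le]
    rw [hset] at hg ⊢
    rcases Nat.eq_zero_or_pos k with rfl | hk0
    · simp [ht0]
    · exact hsurr k hk0 hk _ hlt hle (v k) (hv k) x a _ hg
  have harm : ∀ a, ∫ ω, Y (T_E + T_F) ω ∂(P[|{ω | A ω = a}])
      = ∑ x : 𝕏, ∑ s₀ ∈ 𝕊, (∑ σ ∈ Fintype.piFinset (fun _ : Fin K => 𝕊),
        h (t (K + 1) - t K) (extSeq s₀ σ K) x a
            * ∏ k ∈ Finset.range K,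
                p (t (k + 1) - t k) (extSeq s₀ σ k) (extSeq s₀ σ (k + 1)) x a)
          * (P {ω | X ω = x ∧ S 0 ω = s₀}).toReal := by
    intro a
    have hAm : MeasurableSet {ω | A ω = a} := hA (measurableSet_singleton a)
    have hPA : P.real {ω | A ω = a} ≠ 0 := by
      simpa [Measure.real, ENNReal.toReal_eq_zero_iff] using hApos a
    rw [integral_cond_eq, setIntegral_eq_sum_fiber Finset.univ X (fun _ => Finset.mem_univ _)
      (fun x => hX (measurableSet_singleton x)) hAm (hYint _), Finset.mul_sum]
    refine Finset.sum_congr rfl fun x _ => ?_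
    rw [setIntegral_eq_sum_fiber 𝕊 (S 0) (hSmem 0)
      (fun s => hSmeas 0 (measurableSet_singleton s))
      (B := {ω | A ω = a} ∩ {ω | X ω = x})
      (hAm.inter (hX (measurableSet_singleton x))) (hYint _), Finset.mul_sum]
    refine Finset.sum_congr rfl fun s₀ hs₀ => ?_
    have hset : {ω | A ω = a} ∩ {ω | X ω = x} ∩ {ω | S 0 ω = s₀}
        = {ω | S (t 0) ω = s₀ ∧ ω ∈ {ω | X ω = x ∧ A ω = a}} := by
      ext ω
      simp only [ht0, Set.mem_inter_iff, Set.mem_ofPred_eq]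
      tauto
    have hmul : P.real {ω | S (t 0) ω = s₀ ∧ ω ∈ {ω | X ω = x ∧ A ω = a}}
        = (P {ω | X ω = x ∧ S 0 ω = s₀}).toReal * P.real {ω | A ω = a} := by
      have := hindep.measure_inter_preimage_eq_mul {(x, s₀)} {a}
        (measurableSet_singleton _) (measurableSet_singleton _)
      rw [Measure.real, Measure.real, ← ENNReal.toReal_mul]
      convert congrArg ENNReal.toReal this using 3
      · ext ω
        simp only [ht0, Set.mem_inter_iff, Set.mem_ofPred_eq, Set.mem_preimage,
          Set.mem_singleton_iff, Prod.mk.injEq]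
        tauto
      · congr 1
        ext ω
        simp
      · rfl
    rw [hset, setIntegral_eq_sum_paths 𝕊 (V := fun k => S (t k)) (fun k => hSmeas _)
      (fun k => hSmem _) (hXA x a) (hYint _) K
      (fun k s s' => p (t (k + 1) - t k) s s' x a) (fun s => h (t (K + 1) - t K) s x a)
      ?_ ?_ hs₀, hmul]
    · field_simp
    · intro k hk v hv
      have hs' : MeasurableSet {e : ℝ × (Fin D → ℝ) | e.2 = v (k + 1)} :=
        measurable_snd (measurableSet_singleton _)
      have hSv : ∀ u, MeasurableSet {ω | S u ω = v (k + 1)} := fun u =>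
        hSmeas u (measurableSet_singleton _)
      have hcomp_ind : ∀ u ω, Set.indicator {e : ℝ × (Fin D → ℝ) | e.2 = v (k + 1)}
          (fun _ => (1 : ℝ)) (Y u ω, S u ω)
          = Set.indicator {ω | S u ω = v (k + 1)} (fun _ => (1 : ℝ)) ω := fun u ω => rfl
      have key := hstep k hk.le x a v hv
        (Set.indicator {e : ℝ × (Fin D → ℝ) | e.2 = v (k + 1)} fun _ => (1 : ℝ))
        (measurable_const.indicator hs')
        (by simpa only [hcomp_ind] using (integrable_const (1 : ℝ)).indicator (hSv _))
      simp only [hcomp_ind] at key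
      rw [integral_indicator_const _ (hSv _), integral_indicator_const _ (hSv _)] at key
      simp only [smul_eq_mul, mul_one] at key
      rw [pdef, ← Measure.real, ← key, measureReal_restrict_apply (hSv _)]
      congr 1
      ext ω
      simp only [Set.mem_inter_iff, Set.mem_ofPred_eq, Nat.le_succ_iff]
      constructor
      · rintro ⟨h1, h2⟩
        exact ⟨h1 _ (Or.inr rfl), fun i hi => h1 i (Or.inl hi), h2⟩
      · rintro ⟨h0, h1, h2⟩
        refine ⟨fun i hi => ?_, h2⟩
        rcases hi with hi | rfl
        · exact h1 i hi
        · exact h0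
    · intro v hv
      have key := hstep K le_rfl x a v hv Prod.fst measurable_fst (hYint _)
      rw [hdef, ← key, htlast]
  rw [harm true, harm false]
  simp only [← Finset.sum_sub_distrib, ← Finset.sum_mul, ← sub_mul]
end

section
/- If comparability holds, then parallel trends holds: for all t, t′ ∈ {1,…,T}, every positive integer δ ≤ min(t, t′), all s_1, s_0 ∈ 𝕊 and x ∈ 𝕏, one has h^δ_t(s_1, x, 1) − h^δ_{t′}(s_1, x, 1) = h^δ_t(s_0, x, 0) − h^δ_{t′}(s_0, x, 0); in fact both sides equal zero. -/
open MeasureTheory ProbabilityTheory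

/-- If two pairs of random variables have the same joint law, then their first components have the
same expectation. -/
theorem integral_eq_of_map_prodMk_eq {Ω Ω' β : Type*} [MeasurableSpace Ω] [MeasurableSpace Ω']
    [MeasurableSpace β] {μ : Measure Ω} {ν : Measure Ω'} {f : Ω → ℝ} {g : Ω' → ℝ}
    {u : Ω → β} {v : Ω' → β} (hf : Measurable f) (hg : Measurable g)
    (hu : Measurable u) (hv : Measurable v)
    (h : μ.map (fun ω => (f ω, u ω)) = ν.map (fun ω => (g ω, v ω))) :
    ∫ ω, f ω ∂μ = ∫ ω, g ω ∂ν := by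
  have h_fst : StronglyMeasurable (Prod.fst : ℝ × β → ℝ) := measurable_fst.stronglyMeasurable
  rw [← integral_map (hf.prodMk hu).aemeasurable h_fst.aestronglyMeasurable, h,
    integral_map (hg.prodMk hv).aemeasurable h_fst.aestronglyMeasurable]

/-- Proposition 1: comparability implies parallel trends; moreover both differences
in the parallel-trends identity are in fact zero. -/
theorem comparability_implies_parallel_trends
    {Ω : Type*} [MeasurableSpace Ω] (P : Measure Ω) [IsProbabilityMeasure P]
    {𝕏 : Type*} [Fintype 𝕏] [MeasurableSpace 𝕏] [MeasurableSingletonClass 𝕏]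
    (D T_E T_F : ℕ) (hD : 0 < D) (hTE : 0 < T_E) (hTF : 0 < T_F)
    (𝕊 : Finset (Fin D → ℝ))
    (X : Ω → 𝕏) (hX : Measurable X)
    (S : ℕ → Ω → (Fin D → ℝ)) (hSmeas : ∀ t, Measurable (S t))
    (hSmem : ∀ t ω, S t ω ∈ 𝕊)
    (Y : ℕ → Ω → ℝ) (hYmeas : ∀ t, Measurable (Y t)) (hYint : ∀ t, Integrable (Y t) P)
    (A : Ω → Bool) (hA : Measurable A)
    -- all conditioning events have positive probability
    (hpos : ∀ r, r ≤ T_E + T_F → ∀ s ∈ 𝕊, ∀ (x : 𝕏) (a : Bool),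
      P {ω | S r ω = s ∧ X ω = x ∧ A ω = a} ≠ 0)
    -- the generalized surrogate index `h^δ_t`
    (h : ℕ → ℕ → (Fin D → ℝ) → 𝕏 → Bool → ℝ)
    (hdef : ∀ t δ s x a,
      h t δ s x a = ∫ ω, Y t ω ∂(P[|{ω | S (t - δ) ω = s ∧ X ω = x ∧ A ω = a}]))
    -- comparability
    (hcomp : ∀ r u r' u', r < u → u ≤ T_E + T_F → r' < u' → u' ≤ T_E + T_F →
      u - r = u' - r' → ∀ s ∈ 𝕊, ∀ (x : 𝕏) (a : Bool),
        Measure.map (fun ω => (Y u ω, S u ω)) (P[|{ω | S r ω = s ∧ X ω = x ∧ A ω = a}])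
          = Measure.map (fun ω => (Y u' ω, S u' ω)) (P[|{ω | S r' ω = s ∧ X ω = x ∧ A ω = a}])) :
    ∀ t t' δ, 1 ≤ t → t ≤ T_E + T_F → 1 ≤ t' → t' ≤ T_E + T_F →
      1 ≤ δ → δ ≤ t → δ ≤ t' →
      ∀ s₁ ∈ 𝕊, ∀ s₀ ∈ 𝕊, ∀ x : 𝕏,
        (h t δ s₁ x true - h t' δ s₁ x true = h t δ s₀ x false - h t' δ s₀ x false)
        ∧ h t δ s₁ x true - h t' δ s₁ x true = 0
        ∧ h t δ s₀ x false - h t' δ s₀ x false = 0 := by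
  intro t t' δ _ ht _ ht' hδ hδt hδt' s₁ hs₁ s₀ hs₀ x
  have h_eq (s : Fin D → ℝ) (hs : s ∈ 𝕊) (a : Bool) : h t δ s x a = h t' δ s x a := by
    rw [hdef, hdef]
    exact integral_eq_of_map_prodMk_eq (hYmeas t) (hYmeas t') (hSmeas t) (hSmeas t')
      (hcomp (t - δ) t (t' - δ) t' (by omega) ht (by omega) ht' (by omega) s hs x a)
  simp [h_eq s₁ hs₁ true, h_eq s₀ hs₀ false]
end
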